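/- Let S₁(V₁,E₁) and S₂(V₂,E₂) be mutually independent stars with V₁ ∩ V₂ ≠ ∅. Then there exist mutually independent stars S₁'(V₁',E₁') and S₂'(V₂',E₂') on a circle with V₁' ∩ V₂' = ∅, together with directed-graph isomorphisms from Sᵢ to Sᵢ' for i = 1, 2, such that a pair consisting of an edge of S₁' and an edge of S₂' is crossing if and only if the corresponding pair of edges of S₁ and S₂ is crossing, and a pair consisting of a vertex of S₁' and a vertex of S₂' is linkable if and only if the corresponding pair of vertices of S₁ and S₂ is linkable. -/

import Mathlib

open Complex
open scoped Classical

noncomputable section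

/-- The anticlockwise arc displacement from `u` to `v` on the unit circle, lying in `(0, 2π]`
(equal to `2π` when `v = u`). -/
def posArc (u v : ℂ) : ℝ :=
  if 0 < Complex.arg (v / u) then Complex.arg (v / u) else Complex.arg (v / u) + 2 * Real.pi

/-- `u, v, w` occur in anticlockwise order on the circle. -/
def ACW (u v w : ℂ) : Prop :=
  u ≠ v ∧ v ≠ w ∧ u ≠ w ∧ posArc u v < posArc u w

/-- The open anticlockwise arc from `u` to `v`. -/
def arcOO (u v : ℂ) : Set ℂ := {x | x ≠ u ∧ x ≠ v ∧ posArc u x < posArc u v}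

/-- The anticlockwise arc from `u` to `v`, open at `u` and closed at `v`. -/
def arcOC (u v : ℂ) : Set ℂ := {x | x ≠ u ∧ (x = v ∨ posArc u x < posArc u v)}

/-- The closed anticlockwise arc from `u` to `v`. -/
def arcCC (u v : ℂ) : Set ℂ := {x | x = u ∨ x = v ∨ (x ≠ u ∧ posArc u x < posArc u v)}

/-- The (undirected) angle `∠ x v z` at apex `v`. -/
def vangle (x v z : ℂ) : ℝ := |Complex.arg ((x - v) / (z - v))|

/-- A cyclic polygon: a finite set of vertices on the unit circle together with a set of
directed edges such that every vertex has indegree and outdegree one, and any two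
consecutive edges `uv`, `vw` have `u, v, w` in anticlockwise order. -/
structure CyclicPolygon where
  V : Finset ℂ
  E : Finset (ℂ × ℂ)
  nonempty : V.Nonempty
  onCircle : ∀ v ∈ V, ‖v‖ = 1
  endmem : ∀ e ∈ E, e.1 ∈ V ∧ e.2 ∈ V
  outdeg : ∀ v ∈ V, ∃! w, (v, w) ∈ E
  indeg : ∀ v ∈ V, ∃! u, (u, v) ∈ E
  acw : ∀ u v w : ℂ, (u, v) ∈ E → (v, w) ∈ E → ACW u v w

namespace CyclicPolygon

/-- The successor `v⁺` of a vertex. -/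
noncomputable def next (P : CyclicPolygon) (v : ℂ) : ℂ :=
  if h : ∃ w, (v, w) ∈ P.E then h.choose else v

/-- The predecessor `v⁻` of a vertex. -/
noncomputable def prev (P : CyclicPolygon) (v : ℂ) : ℂ :=
  if h : ∃ u, (u, v) ∈ P.E then h.choose else v

end CyclicPolygon

/-- The interior angle `∠ v⁻ v v⁺` of `P` at `v`. -/
def interiorAngle (P : CyclicPolygon) (v : ℂ) : ℝ :=
  vangle (P.prev v) v (P.next v)

/-- The length of an edge `uv`: the number of vertices on the open anticlockwise
arc from `u` to `v`, plus one. -/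
def edgeLength (P : CyclicPolygon) (u v : ℂ) : ℕ :=
  ((P.V : Set ℂ) ∩ arcOO u v).ncard + 1

/-- A `k`-star: a cyclic polygon with `2k+1` vertices all of whose edges have length `k`. -/
def IsKStar (S : CyclicPolygon) (k : ℕ) : Prop :=
  S.V.card = 2 * k + 1 ∧ ∀ e ∈ S.E, edgeLength S e.1 e.2 = k

/-- A star: a `k`-star for some positive integer `k`. -/
def IsStar (S : CyclicPolygon) : Prop := ∃ k : ℕ, 0 < k ∧ IsKStar S k

/-- The segment from `u` to `x` splits the interior angle `∠ u⁻ u u⁺` of `S` at `u`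
into the two (smaller, nonzero) angles `∠ u⁻ u x` and `∠ x u u⁺`. -/
def SplitsVertexAngle (S : CyclicPolygon) (u x : ℂ) : Prop :=
  u ∈ S.V ∧ 0 < vangle (S.prev u) u x ∧ 0 < vangle x u (S.next u) ∧
    vangle (S.prev u) u x + vangle x u (S.next u) = vangle (S.prev u) u (S.next u)

/-- `(u, v)` is a linkable pair for the pair of cyclic polygons `(S₁, S₂)`:
the segment `uv` splits the angle of `S₁` at `u` and the angle of `S₂` at `v`. -/
def LinkablePair (S₁ S₂ : CyclicPolygon) (u v : ℂ) : Prop :=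
  u ≠ v ∧ SplitsVertexAngle S₁ u v ∧ SplitsVertexAngle S₂ v u

/-- `u, v` is a linkable pair of vertices of the cyclic polygon `P`. -/
def Linkable (P : CyclicPolygon) (u v : ℂ) : Prop := LinkablePair P P u v

/-- `D` is a set of (undirected) diagonals of `P`, i.e. every member joins a linkable pair. -/
def IsDiagonalSet (P : CyclicPolygon) (D : Set (Sym2 ℂ)) : Prop :=
  ∀ u v : ℂ, s(u, v) ∈ D → Linkable P u v

/-- The set `D̃` of directed edges associated to a set of diagonals `D`. -/
def tilde (D : Set (Sym2 ℂ)) : Set (ℂ × ℂ) := {e | s(e.1, e.2) ∈ D}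

/-- The segment from `v` towards `x` splits the angle `∠ u v w`. -/
def SplitsAngle3 (u v w x : ℂ) : Prop :=
  0 < vangle u v x ∧ 0 < vangle x v w ∧ vangle u v x + vangle x v w = vangle u v w

/-- `𝒮` is a star decomposition of `P` with respect to the diagonal set `D`: the
cycle decomposition of `E ∪ D̃` determined by `f_next` (each cycle follows the
tightest turn, i.e. no diagonal of `D` splits the angle between two consecutive
edges of a cycle), all of whose cycles are stars. -/
def IsStarDecomp (P : CyclicPolygon) (D : Set (Sym2 ℂ)) (𝒮 : Finset CyclicPolygon) : Prop :=
  IsDiagonalSet P D ∧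
  (∀ S ∈ 𝒮, IsStar S ∧ (S.V : Set ℂ) ⊆ (P.V : Set ℂ)) ∧
  (∀ S ∈ 𝒮, (S.E : Set (ℂ × ℂ)) ⊆ (P.E : Set (ℂ × ℂ)) ∪ tilde D) ∧
  (∀ e ∈ (P.E : Set (ℂ × ℂ)) ∪ tilde D, ∃ S ∈ 𝒮, e ∈ S.E) ∧
  (∀ S₁ ∈ 𝒮, ∀ S₂ ∈ 𝒮, S₁ ≠ S₂ → ∀ e : ℂ × ℂ, e ∈ S₁.E → e ∉ S₂.E) ∧
  (∀ S ∈ 𝒮, ∀ u v w : ℂ, (u, v) ∈ S.E → (v, w) ∈ S.E →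
      ¬ ∃ x, s(v, x) ∈ D ∧ SplitsAngle3 u v w x)

/-- `P` admits a star decomposition with respect to `D`. -/
def HasStarDecomp (P : CyclicPolygon) (D : Set (Sym2 ℂ)) : Prop :=
  ∃ 𝒮 : Finset CyclicPolygon, IsStarDecomp P D 𝒮

/-- A maximal star decomposition: no proper superset of `D` admits a star decomposition. -/
def IsMaximalStarDecomp (P : CyclicPolygon) (D : Set (Sym2 ℂ))
    (𝒮 : Finset CyclicPolygon) : Prop :=
  IsStarDecomp P D 𝒮 ∧ ∀ D' : Set (Sym2 ℂ), D ⊂ D' → ¬ HasStarDecomp P D'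

/-- `D'` is obtained from `D` by a diagonal flip: remove one diagonal and add another. -/
def FlipStep (D D' : Set (Sym2 ℂ)) : Prop :=
  ∃ e f : Sym2 ℂ, e ∈ D ∧ f ∉ D ∧ D' = (D \ {e}) ∪ {f}

/-- The two chords `ab` and `cd` are crossing: they share no endpoint and
intersect inside the circle. -/
def Crossing (a b c d : ℂ) : Prop :=
  a ≠ c ∧ a ≠ d ∧ b ≠ c ∧ b ≠ d ∧ (openSegment ℝ a b ∩ openSegment ℝ c d).Nonempty

/-- The two chords `ab` and `cd` share a common point: they have a common
endvertex or intersect inside the circle. -/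
def ShareCommonPoint (a b c d : ℂ) : Prop :=
  a = c ∨ a = d ∨ b = c ∨ b = d ∨ (openSegment ℝ a b ∩ openSegment ℝ c d).Nonempty

/-- Two cyclic polygons have a pair of overlapped angles: a common vertex `y` and a vertex
`x` of either polygon lying on both arcs `⦅y⁺ y⁻⟧` (taken in each polygon). -/
def OverlappedAngles (S₁ S₂ : CyclicPolygon) : Prop :=
  ∃ y : ℂ, y ∈ S₁.V ∧ y ∈ S₂.V ∧
    ∃ x : ℂ, (x ∈ S₁.V ∨ x ∈ S₂.V) ∧
      x ∈ arcOC (S₁.next y) (S₁.prev y) ∧ x ∈ arcOC (S₂.next y) (S₂.prev y)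

/-- Two cyclic polygons are mutually independent: no two of their angles are overlapped. -/
def IndepPolygons (S₁ S₂ : CyclicPolygon) : Prop := ¬ OverlappedAngles S₁ S₂

/-- The edge `uv` of `P` is minimal: no edge `xy` of `P` has all vertices of the closed
arc from `x` to `y` inside the open arc from `u` to `v`. -/
def MinimalEdge (P : CyclicPolygon) (u v : ℂ) : Prop :=
  (u, v) ∈ P.E ∧
    ¬ ∃ x y : ℂ, (x, y) ∈ P.E ∧ ∀ z ∈ P.V, z ∈ arcCC x y → z ∈ arcOO u v

/-- `vs` enumerates the star `S` as `v₀ v₁ ⋯ v₂ₖ` with `v₁ = v`, `v₀ = v⁻` (so that `v⁻v`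
is an edge of `S`), each edge of `S` is an edge of `P` or a diagonal of `P`, and all the
edges `v₂ᵢ₋₁v₂ᵢ` are edges of `P`. -/
def IsBorderCandidate (P : CyclicPolygon) (v : ℂ) (S : CyclicPolygon) (k : ℕ)
    (vs : ℕ → ℂ) : Prop :=
  0 < k ∧ IsStar S ∧ S.V.card = 2 * k + 1 ∧
  (S.V : Set ℂ) ⊆ (P.V : Set ℂ) ∧
  vs 0 = P.prev v ∧ vs 1 = v ∧ vs (2 * k + 1) = vs 0 ∧
  (∀ x ∈ S.V, ∃ i ≤ 2 * k, vs i = x) ∧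
  (∀ i ≤ 2 * k, (vs i, vs (i + 1)) ∈ S.E) ∧
  (∀ i ≤ 2 * k, (vs i, vs (i + 1)) ∈ P.E ∨ Linkable P (vs i) (vs (i + 1))) ∧
  (∀ i : ℕ, 1 ≤ i → i ≤ k → (vs (2 * i - 1), vs (2 * i)) ∈ P.E)

/-- The angle sequence `(∠v₁v₂v₃, ∠v₃v₄v₅, …, ∠v₂ₖ₋₁v₂ₖv₀)` of an enumerated star. -/
noncomputable def angleList (vs : ℕ → ℂ) (k : ℕ) : List ℝ :=
  (List.range k).map fun i => vangle (vs (2 * i + 1)) (vs (2 * i + 2)) (vs (2 * i + 3))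

/-- `S` is the border star `S*(P, v)`: among all border candidates, its angle sequence is
lexicographically minimal. -/
def IsBorderStar (P : CyclicPolygon) (v : ℂ) (S : CyclicPolygon) : Prop :=
  ∃ (k : ℕ) (vs : ℕ → ℂ), IsBorderCandidate P v S k vs ∧
    ∀ (S' : CyclicPolygon) (k' : ℕ) (vs' : ℕ → ℂ), IsBorderCandidate P v S' k' vs' →
      ¬ List.Lex (· < ·) (angleList vs' k') (angleList vs k)

lemma posArc_pos (u v : ℂ) : 0 < posArc u v := by
  unfold posArc
  split_ifs with h
  · exact h
  · have := Complex.neg_pi_lt_arg (v / u)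
    have := Real.pi_pos
    linarith

lemma posArc_le (u v : ℂ) : posArc u v ≤ 2 * Real.pi := by
  unfold posArc
  split_ifs with h
  · have := Complex.arg_le_pi (v / u)
    have := Real.pi_pos
    linarith
  · linarith

lemma exp_posArc (u v : ℂ) (hu : ‖u‖ = 1) (hv : ‖v‖ = 1) :
    Complex.exp (posArc u v * I) = v / u := by
  have hn : ‖v / u‖ = 1 := by simp [hu, hv]
  have h := Complex.norm_mul_exp_arg_mul_I (v / u)
  rw [hn] at h
  unfold posArc
  split_ifs
  · simpa using h
  · push_cast
    rw [add_mul, Complex.exp_add, Complex.exp_two_pi_mul_I]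
    simpa using h

lemma exp_inj_Ioc (s t : ℝ) (hs : 0 < s) (hs' : s ≤ 2 * Real.pi) (ht : 0 < t)
    (ht' : t ≤ 2 * Real.pi) (h : Complex.exp (s * I) = Complex.exp (t * I)) : s = t := by
  rw [Complex.exp_eq_exp_iff_exists_int] at h
  obtain ⟨n, hn⟩ := h
  have h2 : s = t + n * (2 * Real.pi) := by
    have := congrArg Complex.im hn
    simpa using this
  have hp := Real.pi_pos
  have h3 : n = 0 := by
    have a1 : (n : ℝ) < 1 := by
      by_contra hc
      push Not at hc
      nlinarith
    have a2 : (-1 : ℝ) < n := by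
      by_contra hc
      push Not at hc
      nlinarith
    have b1 : n < 1 := by exact_mod_cast a1
    have b2 : -1 < n := by exact_mod_cast a2
    omega
  simpa [h3] using h2

/-- Angle of a point. -/
def th (z : ℂ) : ℝ := posArc 1 z

lemma exp_th (z : ℂ) (hz : ‖z‖ = 1) : Complex.exp (th z * I) = z := by
  have := exp_posArc 1 z (by simp) hz
  simpa [th] using this

lemma th_pos (z : ℂ) : 0 < th z := posArc_pos _ _
lemma th_le (z : ℂ) : th z ≤ 2 * Real.pi := posArc_le _ _

lemma norm_exp' (t : ℝ) : ‖Complex.exp (t * I)‖ = 1 := Complex.norm_exp_ofReal_mul_I t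

lemma th_exp (t : ℝ) (h : 0 < t) (h' : t ≤ 2 * Real.pi) : th (Complex.exp (t * I)) = t :=
  exp_inj_Ioc _ _ (th_pos _) (th_le _) h h' (exp_th _ (norm_exp' t))

lemma th_inj {u v : ℂ} (hu : ‖u‖ = 1) (hv : ‖v‖ = 1) (h : th u = th v) : u = v := by
  rw [← exp_th u hu, ← exp_th v hv, h]

lemma posArc_th (u v : ℂ) (hu : ‖u‖ = 1) (hv : ‖v‖ = 1) :
    posArc u v = if th u < th v then th v - th u else th v - th u + 2 * Real.pi := by
  have e : Complex.exp (((th v - th u : ℝ) : ℂ) * I) = v / u := by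
    push_cast
    rw [sub_mul, Complex.exp_sub, exp_th v hv, exp_th u hu]
  have a1 := th_pos u
  have a2 := th_pos v
  have a3 := th_le u
  have a4 := th_le v
  split_ifs with h
  · apply exp_inj_Ioc _ _ (posArc_pos _ _) (posArc_le _ _) (by linarith) (by linarith)
    rw [exp_posArc u v hu hv, e]
  · apply exp_inj_Ioc _ _ (posArc_pos _ _) (posArc_le _ _) (by linarith) (by linarith)
    rw [exp_posArc u v hu hv]
    rw [Complex.ofReal_add, add_mul, Complex.exp_add, e]
    push_cast
    rw [Complex.exp_two_pi_mul_I, mul_one]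

/-- Cyclic order on reals. -/
def C (a b c : ℝ) : Prop := (a < b ∧ b < c) ∨ (b < c ∧ c < a) ∨ (c < a ∧ a < b)

lemma posArc_lt_iff (u x v : ℂ) (hu : ‖u‖ = 1) (hx : ‖x‖ = 1) (hv : ‖v‖ = 1) (hxu : x ≠ u)
    (hvu : v ≠ u) :
    posArc u x < posArc u v ↔ C (th u) (th x) (th v) := by
  rw [posArc_th u x hu hx, posArc_th u v hu hv]
  have n1 : th x ≠ th u := fun h => hxu (th_inj hx hu h)
  have n2 : th v ≠ th u := fun h => hvu (th_inj hv hu h)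
  have a1 := th_pos x
  have a2 := th_pos v
  have a3 := th_le x
  have a4 := th_le v
  unfold C
  rcases lt_or_gt_of_ne n1 with h1 | h1 <;> rcases lt_or_gt_of_ne n2 with h2 | h2
  · rw [if_neg (by linarith), if_neg (by linarith)]
    constructor
    · intro h; right; left; constructor <;> linarith
    · rintro (h | h | h) <;> linarith [h.1, h.2]
  · rw [if_neg (by linarith), if_pos (by linarith)]
    constructor
    · intro h; linarith
    · rintro (h | h | h) <;> linarith [h.1, h.2]
  · rw [if_pos (by linarith), if_neg (by linarith)]
    constructor
    · intro h; right; right; constructor <;> linarith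
    · intro h; linarith
  · rw [if_pos (by linarith), if_pos (by linarith)]
    constructor
    · intro h; left; constructor <;> linarith
    · rintro (h | h | h) <;> linarith [h.1, h.2]

lemma C_ne {a b c : ℝ} (h : C a b c) : a ≠ b ∧ b ≠ c ∧ a ≠ c := by
  unfold C at h
  refine ⟨?_, ?_, ?_⟩ <;> rintro rfl <;> rcases h with h | h | h <;> linarith [h.1, h.2]

lemma C_ne' {a b c : ℂ} (h : C (th a) (th b) (th c)) : a ≠ b ∧ b ≠ c ∧ a ≠ c := by
  have := C_ne h
  refine ⟨?_, ?_, ?_⟩ <;> rintro rfl <;> simp at this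

lemma ACW_iff (u v w : ℂ) (hu : ‖u‖ = 1) (hv : ‖v‖ = 1) (hw : ‖w‖ = 1) :
    ACW u v w ↔ C (th u) (th v) (th w) := by
  constructor
  · rintro ⟨h1, h2, h3, h4⟩
    exact (posArc_lt_iff u v w hu hv hw h1.symm h3.symm).1 h4
  · intro h
    obtain ⟨h1, h2, h3⟩ := C_ne' h
    exact ⟨h1, h2, h3, (posArc_lt_iff u v w hu hv hw h1.symm h3.symm).2 h⟩

lemma arcOO_iff (u v x : ℂ) (hu : ‖u‖ = 1) (hv : ‖v‖ = 1) (hx : ‖x‖ = 1) (huv : u ≠ v) :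
    x ∈ arcOO u v ↔ C (th u) (th x) (th v) := by
  constructor
  · rintro ⟨h1, h2, h4⟩
    exact (posArc_lt_iff u x v hu hx hv h1 huv.symm).1 h4
  · intro h
    obtain ⟨h1, h2, h3⟩ := C_ne' h
    exact ⟨h1.symm, h2, (posArc_lt_iff u x v hu hx hv h1.symm h3.symm).2 h⟩

lemma arcOC_iff (u v x : ℂ) (hu : ‖u‖ = 1) (hv : ‖v‖ = 1) (hx : ‖x‖ = 1) (huv : u ≠ v) :
    x ∈ arcOC u v ↔ x = v ∨ C (th u) (th x) (th v) := by
  constructor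
  · rintro ⟨h1, h2 | h4⟩
    · exact Or.inl h2
    · exact Or.inr ((posArc_lt_iff u x v hu hx hv h1 huv.symm).1 h4)
  · rintro (rfl | h)
    · exact ⟨huv.symm, Or.inl rfl⟩
    · obtain ⟨h1, h2, h3⟩ := C_ne' h
      exact ⟨h1.symm, Or.inr ((posArc_lt_iff u x v hu hx hv h1.symm h3.symm).2 h)⟩

lemma posArc_lt_two_pi (u v : ℂ) (hu : ‖u‖ = 1) (hv : ‖v‖ = 1) (h : v ≠ u) :
    posArc u v < 2 * Real.pi := by
  refine lt_of_le_of_ne (posArc_le u v) fun he => h ?_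
  have := exp_posArc u v hu hv
  rw [he] at this
  push_cast at this
  rw [Complex.exp_two_pi_mul_I] at this
  have hu0 : u ≠ 0 := by rintro rfl; simp at hu
  rw [eq_div_iff hu0] at this
  simpa using this.symm

lemma exp_sub_one' (X : ℝ) : Complex.exp (X * I) - 1 =
    ((2 * Real.sin (X / 2) : ℝ) : ℂ) * (I * Complex.exp (((X / 2 : ℝ) : ℂ) * I)) := by
  have h : X = X / 2 + X / 2 := by ring
  have e : Complex.exp (X * I) = Complex.exp (((X / 2 : ℝ) : ℂ) * I) * Complex.exp (((X / 2 : ℝ) : ℂ) * I) := by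
    rw [← Complex.exp_add]; congr 1; push_cast; ring
  rw [e, Complex.exp_mul_I, ← Complex.ofReal_cos, ← Complex.ofReal_sin]
  have := Real.sin_sq_add_cos_sq (X / 2)
  generalize Real.sin (X / 2) = s at *
  generalize Real.cos (X / 2) = c at *
  apply Complex.ext
  · simp
    nlinarith
  · simp
    ring

lemma vangle_eq (x v z : ℂ) (hx : ‖x‖ = 1) (hv : ‖v‖ = 1) (hz : ‖z‖ = 1) (hxv : x ≠ v)
    (hzv : z ≠ v) : vangle x v z = |posArc v x - posArc v z| / 2 := by
  have hv0 : v ≠ 0 := by rintro rfl; simp at hv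
  set X := posArc v x with hX
  set Z := posArc v z with hZ
  have x1 : 0 < X := posArc_pos _ _
  have z1 : 0 < Z := posArc_pos _ _
  have x2 : X < 2 * Real.pi := posArc_lt_two_pi v x hv hx hxv
  have z2 : Z < 2 * Real.pi := posArc_lt_two_pi v z hv hz hzv
  have sx : 0 < Real.sin (X / 2) := Real.sin_pos_of_pos_of_lt_pi (by linarith) (by linarith)
  have sz : 0 < Real.sin (Z / 2) := Real.sin_pos_of_pos_of_lt_pi (by linarith) (by linarith)
  have ex : x - v = v * (Complex.exp (X * I) - 1) := by
    rw [hX, exp_posArc v x hv hx]; field_simp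
  have ez : z - v = v * (Complex.exp (Z * I) - 1) := by
    rw [hZ, exp_posArc v z hv hz]; field_simp
  have key : (x - v) / (z - v) = ((Real.sin (X / 2) / Real.sin (Z / 2) : ℝ) : ℂ) *
      Complex.exp (((X / 2 - Z / 2 : ℝ) : ℂ) * I) := by
    rw [ex, ez, mul_div_mul_left _ _ hv0, exp_sub_one', exp_sub_one']
    have : ((X / 2 - Z / 2 : ℝ) : ℂ) * I = ((X / 2 : ℝ) : ℂ) * I - ((Z / 2 : ℝ) : ℂ) * I := by
      push_cast; ring
    rw [this, Complex.exp_sub]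
    have s0 : ((Real.sin (Z / 2) : ℝ) : ℂ) ≠ 0 := by exact_mod_cast sz.ne'
    have e0 := Complex.exp_ne_zero (((Z / 2 : ℝ) : ℂ) * I)
    have i0 := Complex.I_ne_zero
    rw [Complex.ofReal_mul, Complex.ofReal_mul, Complex.ofReal_div (Real.sin (X / 2))]
    field_simp
  unfold vangle
  rw [key, Complex.arg_real_mul _ (div_pos sx sz), Complex.arg_exp_mul_I,
    (toIocMod_eq_self _).2]
  · rw [← sub_div, abs_div, abs_two]
  · constructor <;> linarith

lemma vangle_self (x v : ℂ) : vangle x v v = 0 := by simp [vangle]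

lemma C3 (n u p x : ℂ) (hn : ‖n‖ = 1) (hu : ‖u‖ = 1) (hp : ‖p‖ = 1) (hx : ‖x‖ = 1)
    (hc : C (th p) (th u) (th n)) (hxu : x ≠ u) :
    C (th n) (th x) (th p) ↔ (posArc u n < posArc u x ∧ posArc u x < posArc u p) := by
  obtain ⟨h1, h2, h3⟩ := C_ne' hc
  have e1 := posArc_lt_iff u n x hu hn hx h2.symm hxu
  have e2 := posArc_lt_iff u x p hu hx hp hxu h1
  rw [e1, e2]
  unfold C at *
  constructor
  · intro h
    constructor <;> rcases hc with hc | hc | hc <;> rcases h with h | h | h <;>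
      first
      | exact Or.inl ⟨by linarith [h.1, h.2, hc.1, hc.2], by linarith [h.1, h.2, hc.1, hc.2]⟩
      | exact Or.inr (Or.inl ⟨by linarith [h.1, h.2, hc.1, hc.2], by linarith [h.1, h.2, hc.1, hc.2]⟩)
      | exact Or.inr (Or.inr ⟨by linarith [h.1, h.2, hc.1, hc.2], by linarith [h.1, h.2, hc.1, hc.2]⟩)
  · rintro ⟨h, h'⟩
    rcases h' with h' | h' | h' <;> rcases h with h | h | h <;>
      first
      | exact Or.inl ⟨by linarith [h.1, h.2, h'.1, h'.2], by linarith [h.1, h.2, h'.1, h'.2]⟩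
      | exact Or.inr (Or.inl ⟨by linarith [h.1, h.2, h'.1, h'.2], by linarith [h.1, h.2, h'.1, h'.2]⟩)
      | exact Or.inr (Or.inr ⟨by linarith [h.1, h.2, h'.1, h'.2], by linarith [h.1, h.2, h'.1, h'.2]⟩)

lemma split_iff (n u p x : ℂ) (hn : ‖n‖ = 1) (hu : ‖u‖ = 1) (hp : ‖p‖ = 1) (hx : ‖x‖ = 1)
    (hc : C (th p) (th u) (th n)) :
    (0 < vangle p u x ∧ 0 < vangle x u n ∧ vangle p u x + vangle x u n = vangle p u n) ↔
      C (th n) (th x) (th p) := by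
  obtain ⟨h1, h2, h3⟩ := C_ne' hc
  by_cases hxu : x = u
  · subst hxu
    rw [vangle_self]
    simp
    unfold C at *
    intro h
    rcases hc with hc | hc | hc <;> rcases h with h | h | h <;> linarith [h.1, h.2, hc.1, hc.2]
  rw [vangle_eq p u x hp hu hx h1 hxu, vangle_eq x u n hx hu hn hxu h2.symm,
    vangle_eq p u n hp hu hn h1 h2.symm]
  have hc' : C (th u) (th n) (th p) := by unfold C at *; tauto
  have hnp := (posArc_lt_iff u n p hu hn hp h2.symm h1).2 hc'
  rw [C3 n u p x hn hu hp hx hc hxu]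
  generalize posArc u n = N at *
  generalize posArc u x = X at *
  generalize posArc u p = P at *
  constructor
  · rintro ⟨a, b, c⟩
    have hPX : P ≠ X := by rintro rfl; simp at a
    have hNX : X ≠ N := by rintro rfl; simp at b
    rcases lt_or_gt_of_ne hPX with q | q <;> rcases lt_or_gt_of_ne hNX with r | r
    · linarith
    · rw [abs_of_neg (by linarith), abs_of_pos (by linarith), abs_of_pos (by linarith)] at c
      linarith
    · rw [abs_of_pos (by linarith), abs_of_neg (by linarith), abs_of_pos (by linarith)] at c
      linarith
    · exact ⟨r, q⟩
  · rintro ⟨a, b⟩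
    rw [abs_of_pos (by linarith), abs_of_pos (by linarith), abs_of_pos (by linarith)]
    refine ⟨by linarith, by linarith, by linarith⟩

/-- Orientation determinant. -/
def cr (a b c : ℂ) : ℝ := (b.re - a.re) * (c.im - a.im) - (b.im - a.im) * (c.re - a.re)

lemma cr_eq (α β γ : ℝ) : cr (Complex.exp (α * I)) (Complex.exp (β * I)) (Complex.exp (γ * I)) =
    4 * Real.sin ((β - α) / 2) * Real.sin ((γ - β) / 2) * Real.sin ((γ - α) / 2) := by
  unfold cr
  simp only [Complex.exp_ofReal_mul_I_re, Complex.exp_ofReal_mul_I_im]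
  have e1 : ∀ a b : ℝ, Real.cos b - Real.cos a = - 2 * Real.sin ((b + a) / 2) * Real.sin ((b - a) / 2) :=
    fun a b => Real.cos_sub_cos b a
  have e2 : ∀ a b : ℝ, Real.sin b - Real.sin a = 2 * Real.sin ((b - a) / 2) * Real.cos ((b + a) / 2) :=
    fun a b => Real.sin_sub_sin b a
  rw [e1, e1, e2, e2]
  have e3 : (γ - β) / 2 = (γ + α) / 2 - (β + α) / 2 := by ring
  rw [e3, Real.sin_sub]
  ring

lemma sin_half_pos {d : ℝ} (h : 0 < d) (h' : d < 2 * Real.pi) : 0 < Real.sin (d / 2) :=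
  Real.sin_pos_of_pos_of_lt_pi (by linarith) (by linarith)

lemma sin_half_neg {d : ℝ} (h : d < 0) (h' : - (2 * Real.pi) < d) : Real.sin (d / 2) < 0 :=
  Real.sin_neg_of_neg_of_neg_pi_lt (by linarith) (by linarith)

lemma cr_pos (a b c : ℂ) (ha : ‖a‖ = 1) (hb : ‖b‖ = 1) (hc : ‖c‖ = 1)
    (h : C (th a) (th b) (th c)) : 0 < cr a b c := by
  rw [← exp_th a ha, ← exp_th b hb, ← exp_th c hc, cr_eq]
  have := th_pos a
  have := th_pos b
  have := th_pos c
  have := th_le a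
  have := th_le b
  have := th_le c
  rcases h with h | h | h
  · have s1 := sin_half_pos (d := th b - th a) (by linarith [h.1, h.2]) (by linarith)
    have s2 := sin_half_pos (d := th c - th b) (by linarith [h.1, h.2]) (by linarith)
    have s3 := sin_half_pos (d := th c - th a) (by linarith [h.1, h.2]) (by linarith)
    positivity
  · have s1 := sin_half_neg (d := th b - th a) (by linarith [h.1, h.2]) (by linarith)
    have s2 := sin_half_pos (d := th c - th b) (by linarith [h.1, h.2]) (by linarith)
    have s3 := sin_half_neg (d := th c - th a) (by linarith [h.1, h.2]) (by linarith)
    have := mul_pos (mul_pos_of_neg_of_neg s1 s3) s2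
    linarith
  · have s1 := sin_half_pos (d := th b - th a) (by linarith [h.1, h.2]) (by linarith)
    have s2 := sin_half_neg (d := th c - th b) (by linarith [h.1, h.2]) (by linarith)
    have s3 := sin_half_neg (d := th c - th a) (by linarith [h.1, h.2]) (by linarith)
    have := mul_pos (mul_pos_of_neg_of_neg s2 s3) s1
    linarith

lemma C_total {a b c : ℝ} (h1 : a ≠ b) (h2 : b ≠ c) (h3 : a ≠ c) : C a b c ∨ C a c b := by
  unfold C
  rcases lt_or_gt_of_ne h1 with q | q <;> rcases lt_or_gt_of_ne h2 with r | r <;>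
    rcases lt_or_gt_of_ne h3 with s | s <;> simp [*]

lemma cr_swap (a b c : ℂ) : cr a c b = - cr a b c := by unfold cr; ring

/-- interleaving -/
def Il (a b c d : ℝ) : Prop := (C a c b ∧ C a b d) ∨ (C a d b ∧ C a b c)

lemma crossing_iff (a b c d : ℂ) (ha : ‖a‖ = 1) (hb : ‖b‖ = 1) (hc : ‖c‖ = 1) (hd : ‖d‖ = 1)
    (hab : a ≠ b) : Crossing a b c d ↔ Il (th a) (th b) (th c) (th d) := by
  have ne : ∀ {x y : ℂ}, ‖x‖ = 1 → ‖y‖ = 1 → x ≠ y → th x ≠ th y :=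
    fun hx hy h h' => h (th_inj hx hy h')
  have aff : ∀ (c d : ℂ) (s t : ℝ), s + t = 1 → cr a b (s • c + t • d) = s * cr a b c + t * cr a b d := by
    intro c d s t hst
    have : s = 1 - t := by linarith
    subst this
    unfold cr
    simp
    ring
  constructor
  · rintro ⟨h1, h2, h3, h4, P, hP1, hP2⟩
    obtain ⟨s, t, hs, ht, hst, rfl⟩ := hP1
    obtain ⟨s', t', hs', ht', hst', hP⟩ := hP2
    have z : s' * cr a b c + t' * cr a b d = 0 := by
      rw [← aff c d s' t' hst', hP]
      have : s = 1 - t := by linarith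
      subst this
      unfold cr
      simp
      ring
    rcases C_total (ne ha hb hab) (ne hb hc h3) (ne ha hc h1) with q | q <;>
    rcases C_total (ne ha hb hab) (ne hb hd h4) (ne ha hd h2) with r | r
    · have := cr_pos _ _ _ ha hb hc q
      have := cr_pos _ _ _ ha hb hd r
      have : 0 < s' * cr a b c + t' * cr a b d := by positivity
      linarith
    · exact Or.inr ⟨r, q⟩
    · exact Or.inl ⟨q, r⟩
    · have u1 := cr_pos _ _ _ ha hc hb q
      have u2 := cr_pos _ _ _ ha hd hb r
      rw [cr_swap] at u1 u2
      have : 0 < s' * (-cr a b c) + t' * (-cr a b d) := by positivity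
      linarith
  · intro h
    have key : ∀ c d : ℂ, ‖c‖ = 1 → ‖d‖ = 1 → C (th a) (th c) (th b) → C (th a) (th b) (th d) →
        ∃ s t : ℝ, 0 < s ∧ 0 < t ∧ s + t = 1 ∧ cr a b (s • c + t • d) = s * cr a b c + t * cr a b d ∧
          cr a b (s • c + t • d) = 0 ∧ c ≠ d := by
      intro c d hc hd q r
      have u1 := cr_pos _ _ _ ha hc hb q
      have u2 := cr_pos _ _ _ ha hb hd r
      rw [cr_swap] at u1
      set A := cr a b c
      set B := cr a b d
      have e : cr a b ((B / (B - A)) • c + (-A / (B - A)) • d) = 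
          B / (B - A) * A + -A / (B - A) * B := by
        apply aff
        have : B - A ≠ 0 := by linarith
        field_simp
        ring
      have : 0 < B - A := by linarith
      refine ⟨B / (B - A), -A / (B - A), div_pos u2 this, div_pos u1 this, ?_, e, ?_, ?_⟩
      · field_simp
        ring
      · rw [e]; ring
      · rintro rfl
        linarith [show A = B from rfl]
    have fin : ∀ c d : ℂ, ‖c‖ = 1 → ‖d‖ = 1 → C (th a) (th c) (th b) → C (th a) (th b) (th d) →
        (openSegment ℝ a b ∩ openSegment ℝ c d).Nonempty := by
      intro c d hc hd q r
      obtain ⟨s, t, hs, ht, hst, -, h0, hcd⟩ := key c d hc hd q r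
      refine ⟨s • c + t • d, ?_, ⟨s, t, hs, ht, hst, rfl⟩⟩
      have hlt : ‖s • c + t • d‖ < 1 := norm_combo_lt_of_ne hc.le hd.le hcd hs ht hst
      set Q := s • c + t • d with hQ
      have nsq : ∀ z : ℂ, ‖z‖ ^ 2 = z.re ^ 2 + z.im ^ 2 := by
        intro z; rw [Complex.sq_norm, Complex.normSq_apply]; ring
      have L : 0 < (b.re - a.re) ^ 2 + (b.im - a.im) ^ 2 := by
        have := nsq (b - a)
        simp at this
        rw [← this]
        have : 0 < ‖b - a‖ := norm_pos_iff.2 (sub_ne_zero.2 hab.symm)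
        positivity
      obtain ⟨l, hl⟩ : ∃ l : ℝ, l = ((Q.re - a.re) * (b.re - a.re) + (Q.im - a.im) * (b.im - a.im)) /
        ((b.re - a.re) ^ 2 + (b.im - a.im) ^ 2) := ⟨_, rfl⟩
      rw [eq_div_iff L.ne'] at hl
      unfold cr at h0
      have hre : Q.re = a.re + l * (b.re - a.re) := by
        apply mul_right_cancel₀ L.ne'
        linear_combination (b.re - a.re) * (-hl) - (b.im - a.im) * h0
      have him : Q.im = a.im + l * (b.im - a.im) := by
        apply mul_right_cancel₀ L.ne'
        linear_combination (b.im - a.im) * (-hl) + (b.re - a.re) * h0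
      have na := nsq a
      have nb := nsq b
      have nQ := nsq Q
      rw [ha] at na
      rw [hb] at nb
      have hQ1 : ‖Q‖ ^ 2 < 1 := by
        have := norm_nonneg Q
        nlinarith
      have pr : 0 < l * (1 - l) := by
        have : ‖Q‖ ^ 2 = 1 - l * (1 - l) * ((b.re - a.re) ^ 2 + (b.im - a.im) ^ 2) := by
          rw [nQ, hre, him]
          linear_combination (-(1 - l)) * na - l * nb
        by_contra hcon
        push Not at hcon
        nlinarith
      have l0 : 0 < l := by
        by_contra hcon
        nlinarith
      have l1 : 0 < 1 - l := by
        by_contra hcon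
        nlinarith
      refine ⟨1 - l, l, l1, l0, by ring, ?_⟩
      apply Complex.ext
      · rw [hre]; simp; ring
      · rw [him]; simp; ring
    rcases h with ⟨q, r⟩ | ⟨q, r⟩
    · have q' := C_ne' q
      have r' := C_ne' r
      exact ⟨q'.1, r'.2.2, q'.2.1.symm, r'.2.1, fin c d hc hd q r⟩
    · have q' := C_ne' q
      have r' := C_ne' r
      refine ⟨r'.2.2, q'.1, r'.2.1, q'.2.1.symm, ?_⟩
      rw [openSegment_symm ℝ c d]
      exact fin d c hd hc q r

lemma C_rot {a b c : ℝ} : C a b c ↔ C b c a := by unfold C; tauto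

namespace CyclicPolygon

lemma edge_next (P : CyclicPolygon) {v : ℂ} (hv : v ∈ P.V) : (v, P.next v) ∈ P.E := by
  have h : ∃ w, (v, w) ∈ P.E := (P.outdeg v hv).exists
  unfold next
  rw [dif_pos h]
  exact h.choose_spec

lemma edge_prev (P : CyclicPolygon) {v : ℂ} (hv : v ∈ P.V) : (P.prev v, v) ∈ P.E := by
  have h : ∃ w, (w, v) ∈ P.E := (P.indeg v hv).exists
  unfold prev
  rw [dif_pos h]
  exact h.choose_spec

lemma next_eq (P : CyclicPolygon) {v w : ℂ} (h : (v, w) ∈ P.E) : P.next v = w :=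
  (P.outdeg v (P.endmem _ h).1).unique (P.edge_next (P.endmem _ h).1) h

lemma prev_eq (P : CyclicPolygon) {v w : ℂ} (h : (v, w) ∈ P.E) : P.prev w = v :=
  (P.indeg w (P.endmem _ h).2).unique (P.edge_prev (P.endmem _ h).2) h

lemma next_mem (P : CyclicPolygon) {v : ℂ} (hv : v ∈ P.V) : P.next v ∈ P.V :=
  (P.endmem _ (P.edge_next hv)).2

lemma prev_mem (P : CyclicPolygon) {v : ℂ} (hv : v ∈ P.V) : P.prev v ∈ P.V :=
  (P.endmem _ (P.edge_prev hv)).1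

lemma C_edge (P : CyclicPolygon) {u v w : ℂ} (h : (u, v) ∈ P.E) (h' : (v, w) ∈ P.E) :
    C (th u) (th v) (th w) :=
  (ACW_iff u v w (P.onCircle _ (P.endmem _ h).1) (P.onCircle _ (P.endmem _ h).2)
    (P.onCircle _ (P.endmem _ h').2)).1 (P.acw u v w h h')

lemma C_vert (P : CyclicPolygon) {v : ℂ} (hv : v ∈ P.V) :
    C (th (P.prev v)) (th v) (th (P.next v)) := P.C_edge (P.edge_prev hv) (P.edge_next hv)

lemma edge_ne (P : CyclicPolygon) {u v : ℂ} (h : (u, v) ∈ P.E) : u ≠ v :=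
  (C_ne' (P.C_edge h (P.edge_next (P.endmem _ h).2))).1

end CyclicPolygon

lemma splits_iff (S : CyclicPolygon) (u x : ℂ) (hu : u ∈ S.V) (hx : ‖x‖ = 1) :
    SplitsVertexAngle S u x ↔ C (th (S.next u)) (th x) (th (S.prev u)) := by
  unfold SplitsVertexAngle
  rw [split_iff _ _ _ _ (S.onCircle _ (S.next_mem hu)) (S.onCircle _ hu)
    (S.onCircle _ (S.prev_mem hu)) hx (S.C_vert hu)]
  simp [hu]

lemma linkable_iff (S₁ S₂ : CyclicPolygon) (a b : ℂ) (ha : a ∈ S₁.V) (hb : b ∈ S₂.V) :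
    LinkablePair S₁ S₂ a b ↔ a ≠ b ∧ C (th (S₁.next a)) (th b) (th (S₁.prev a)) ∧
      C (th (S₂.next b)) (th a) (th (S₂.prev b)) := by
  unfold LinkablePair
  rw [splits_iff S₁ a b ha (S₂.onCircle _ hb), splits_iff S₂ b a hb (S₁.onCircle _ ha)]

/-- Admissible new positions for the vertices of a polygon. -/
def Good (P : CyclicPolygon) (p : ℂ → ℝ) : Prop :=
  (∀ v ∈ P.V, 0 < p v ∧ p v ≤ 2 * Real.pi) ∧
  ∀ u ∈ P.V, ∀ v ∈ P.V, (p u < p v ↔ th u < th v)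

/-- The point at angle `p v`. -/
def ph (p : ℂ → ℝ) (v : ℂ) : ℂ := Complex.exp (p v * I)

lemma Good.th_ph {P : CyclicPolygon} {p : ℂ → ℝ} (h : Good P p) {v : ℂ} (hv : v ∈ P.V) :
    th (ph p v) = p v := th_exp _ (h.1 v hv).1 (h.1 v hv).2

lemma Good.C_iff {P : CyclicPolygon} {p : ℂ → ℝ} (h : Good P p) {u v w : ℂ} (hu : u ∈ P.V)
    (hv : v ∈ P.V) (hw : w ∈ P.V) : C (p u) (p v) (p w) ↔ C (th u) (th v) (th w) := by
  unfold C
  rw [h.2 u hu v hv, h.2 v hv w hw, h.2 w hw u hu]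

lemma norm_ph (p : ℂ → ℝ) (v : ℂ) : ‖ph p v‖ = 1 := norm_exp' _

lemma Good.inj {P : CyclicPolygon} {p : ℂ → ℝ} (h : Good P p) {u v : ℂ} (hu : u ∈ P.V)
    (hv : v ∈ P.V) (he : ph p u = ph p v) : u = v := by
  have e : p u = p v := by rw [← h.th_ph hu, ← h.th_ph hv, he]
  apply th_inj (P.onCircle u hu) (P.onCircle v hv)
  have h1 := h.2 u hu v hv
  have h2 := h.2 v hv u hu
  rw [e] at h1 h2
  simp at h1 h2
  linarith

lemma Good.edge_iff {P : CyclicPolygon} {p : ℂ → ℝ} (h : Good P p) {u v : ℂ} (hu : u ∈ P.V)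
    (hv : v ∈ P.V) : (ph p u, ph p v) ∈ P.E.image (Prod.map (ph p) (ph p)) ↔ (u, v) ∈ P.E := by
  rw [Finset.mem_image]
  constructor
  · rintro ⟨⟨a, b⟩, hab, he⟩
    simp only [Prod.map_apply, Prod.mk.injEq] at he
    have h1 := h.inj (P.endmem _ hab).1 hu he.1
    have h2 := h.inj (P.endmem _ hab).2 hv he.2
    simp only at h1 h2
    rw [← h1, ← h2]
    exact hab
  · intro he
    exact ⟨(u, v), he, rfl⟩

/-- The polygon with vertices moved to new positions. -/
def mapPoly (P : CyclicPolygon) (p : ℂ → ℝ) (h : Good P p) : CyclicPolygon where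
  V := P.V.image (ph p)
  E := P.E.image (Prod.map (ph p) (ph p))
  nonempty := P.nonempty.image _
  onCircle := by
    intro v hv
    obtain ⟨u, -, rfl⟩ := Finset.mem_image.1 hv
    exact norm_ph _ _
  endmem := by
    intro e he
    obtain ⟨⟨a, b⟩, hab, rfl⟩ := Finset.mem_image.1 he
    exact ⟨Finset.mem_image_of_mem _ (P.endmem _ hab).1,
      Finset.mem_image_of_mem _ (P.endmem _ hab).2⟩
  outdeg := by
    intro v hv
    obtain ⟨u, hu, rfl⟩ := Finset.mem_image.1 hv
    refine ⟨ph p (P.next u), (h.edge_iff hu (P.next_mem hu)).2 (P.edge_next hu), ?_⟩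
    intro w hw
    obtain ⟨⟨a, b⟩, hab, he⟩ := Finset.mem_image.1 hw
    simp only [Prod.map_apply, Prod.mk.injEq] at he
    have h1 := h.inj (P.endmem _ hab).1 hu he.1
    simp only at h1
    subst h1
    rw [P.next_eq hab, he.2]
  indeg := by
    intro v hv
    obtain ⟨u, hu, rfl⟩ := Finset.mem_image.1 hv
    refine ⟨ph p (P.prev u), (h.edge_iff (P.prev_mem hu) hu).2 (P.edge_prev hu), ?_⟩
    intro w hw
    obtain ⟨⟨a, b⟩, hab, he⟩ := Finset.mem_image.1 hw
    simp only [Prod.map_apply, Prod.mk.injEq] at he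
    have h1 := h.inj (P.endmem _ hab).2 hu he.2
    simp only at h1
    subst h1
    rw [P.prev_eq hab, he.1]
  acw := by
    intro u v w huv hvw
    obtain ⟨⟨a, b⟩, hab, he⟩ := Finset.mem_image.1 huv
    obtain ⟨⟨b', c⟩, hbc, he'⟩ := Finset.mem_image.1 hvw
    simp only [Prod.map_apply, Prod.mk.injEq] at he he'
    obtain ⟨rfl, rfl⟩ := he
    obtain ⟨hb, rfl⟩ := he'
    have h1 := h.inj (P.endmem _ hbc).1 (P.endmem _ hab).2 hb
    simp only at h1
    subst h1
    rw [ACW_iff _ _ _ (norm_ph _ _) (norm_ph _ _) (norm_ph _ _)]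
    have m1 := (P.endmem _ hab).1
    have m2 := (P.endmem _ hab).2
    have m3 := (P.endmem _ hbc).2
    simp only at m1 m2 m3
    rw [h.th_ph m1, h.th_ph m2, h.th_ph m3, h.C_iff m1 m2 m3]
    exact P.C_edge hab hbc

section
variable {P : CyclicPolygon} {p : ℂ → ℝ} (h : Good P p)

lemma mem_map {v : ℂ} (hv : v ∈ P.V) : ph p v ∈ (mapPoly P p h).V := Finset.mem_image_of_mem _ hv

lemma map_edge {u v : ℂ} (hu : u ∈ P.V) (hv : v ∈ P.V) :
    (u, v) ∈ P.E ↔ (ph p u, ph p v) ∈ (mapPoly P p h).E := (h.edge_iff hu hv).symm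

lemma map_next {v : ℂ} (hv : v ∈ P.V) : (mapPoly P p h).next (ph p v) = ph p (P.next v) :=
  CyclicPolygon.next_eq _ ((map_edge h hv (P.next_mem hv)).1 (P.edge_next hv))

lemma map_prev {v : ℂ} (hv : v ∈ P.V) : (mapPoly P p h).prev (ph p v) = ph p (P.prev v) :=
  CyclicPolygon.prev_eq _ ((map_edge h (P.prev_mem hv) hv).1 (P.edge_prev hv))

lemma map_bij : Set.BijOn (ph p) (P.V : Set ℂ) ((mapPoly P p h).V : Set ℂ) := by
  refine ⟨fun v hv => mem_map h hv, fun u hu v hv he => h.inj hu hv he, ?_⟩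
  intro v hv
  obtain ⟨u, hu, rfl⟩ := Finset.mem_image.1 hv
  exact ⟨u, hu, rfl⟩

lemma map_star (hs : IsStar P) : IsStar (mapPoly P p h) := by
  obtain ⟨k, hk, hc, hl⟩ := hs
  refine ⟨k, hk, ?_, ?_⟩
  · rw [← hc]
    exact Finset.card_image_of_injOn fun u hu v hv he => h.inj hu hv he
  · intro e he
    obtain ⟨⟨a, b⟩, hab, rfl⟩ := Finset.mem_image.1 he
    rw [← hl _ hab]
    have m1 := (P.endmem _ hab).1
    have m2 := (P.endmem _ hab).2
    simp only at m1 m2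
    have hne := P.edge_ne hab
    unfold edgeLength
    simp only [Prod.map_apply]
    congr 1
    have : ((mapPoly P p h).V : Set ℂ) ∩ arcOO (ph p a) (ph p b) =
        ph p '' ((P.V : Set ℂ) ∩ arcOO a b) := by
      ext x
      constructor
      · rintro ⟨hx, hx'⟩
        obtain ⟨u, hu, rfl⟩ := Finset.mem_image.1 hx
        refine ⟨u, ⟨hu, ?_⟩, rfl⟩
        rw [arcOO_iff _ _ _ (norm_ph _ _) (norm_ph _ _) (norm_ph _ _)
          (fun q => hne (h.inj m1 m2 q)), h.th_ph m1, h.th_ph m2, h.th_ph hu, h.C_iff m1 hu m2] at hx'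
        rwa [arcOO_iff _ _ _ (P.onCircle _ m1) (P.onCircle _ m2) (P.onCircle _ hu) hne]
      · rintro ⟨u, ⟨hu, hx⟩, rfl⟩
        refine ⟨mem_map h hu, ?_⟩
        rw [arcOO_iff _ _ _ (norm_ph _ _) (norm_ph _ _) (norm_ph _ _)
          (fun q => hne (h.inj m1 m2 q)), h.th_ph m1, h.th_ph m2, h.th_ph hu, h.C_iff m1 hu m2]
        rwa [arcOO_iff _ _ _ (P.onCircle _ m1) (P.onCircle _ m2) (P.onCircle _ hu) hne] at hx
    rw [this]
    apply Set.InjOn.ncard_image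
    intro u hu v hv he
    exact h.inj hu.1 hv.1 he

end

lemma exists_gap (T : Finset ℝ) : ∃ ε : ℝ, 0 < ε ∧ ∀ x ∈ T, ∀ y ∈ T, x < y → x < y - ε := by
  have h : ∀ᶠ ε : ℝ in nhdsWithin 0 (Set.Ioi 0), ∀ x ∈ T, ∀ y ∈ T, x < y → x < y - ε := by
    rw [Filter.eventually_all_finset]
    intro x _
    rw [Filter.eventually_all_finset]
    intro y _
    by_cases hxy : x < y
    · have := Ioo_mem_nhdsGT (show (0 : ℝ) < y - x by linarith)
      filter_upwards [this] with e he _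
      linarith [he.2]
    · simp [hxy]
  obtain ⟨ε, h1, h2⟩ := (h.and self_mem_nhdsWithin).exists
  exact ⟨ε, h2, h1⟩

lemma posArc_inj (y x z : ℂ) (hy : ‖y‖ = 1) (hx : ‖x‖ = 1) (hz : ‖z‖ = 1)
    (h : posArc y x = posArc y z) : x = z := by
  have h1 := exp_posArc y x hy hx
  rw [h, exp_posArc y z hy hz] at h1
  have hy0 : y ≠ 0 := by rintro rfl; simp at hy
  field_simp at h1
  exact h1.symm

/-- At a common vertex the two angle arcs are separated. -/
lemma indep_sep (S₁ S₂ : CyclicPolygon) (hind : IndepPolygons S₁ S₂) (y : ℂ) (h1 : y ∈ S₁.V)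
    (h2 : y ∈ S₂.V) : posArc y (S₁.prev y) ≤ posArc y (S₂.next y) ∨
      posArc y (S₂.prev y) ≤ posArc y (S₁.next y) := by
  by_contra hcon
  push Not at hcon
  obtain ⟨q1, q2⟩ := hcon
  have hy := S₁.onCircle y h1
  have c1 := S₁.C_vert h1
  have c2 := S₂.C_vert h2
  have n1 := S₁.onCircle _ (S₁.next_mem h1)
  have p1 := S₁.onCircle _ (S₁.prev_mem h1)
  have n2 := S₂.onCircle _ (S₂.next_mem h2)
  have p2 := S₂.onCircle _ (S₂.prev_mem h2)
  obtain ⟨d1, d2, d3⟩ := C_ne' c1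
  obtain ⟨e1, e2, e3⟩ := C_ne' c2
  apply hind
  refine ⟨y, h1, h2, ?_⟩
  rcases le_total (posArc y (S₁.prev y)) (posArc y (S₂.prev y)) with q | q
  · refine ⟨S₁.prev y, Or.inl (S₁.prev_mem h1), ?_, ?_⟩
    · rw [arcOC_iff _ _ _ n1 p1 p1 d3.symm]
      exact Or.inl rfl
    · rw [arcOC_iff _ _ _ n2 p2 p1 e3.symm, C3 _ y _ _ n2 hy p2 p1 c2 d1]
      rcases eq_or_lt_of_le q with q | q
      · exact Or.inl (posArc_inj y _ _ hy p1 p2 q)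
      · exact Or.inr ⟨q1, q⟩
  · refine ⟨S₂.prev y, Or.inr (S₂.prev_mem h2), ?_, ?_⟩
    · rw [arcOC_iff _ _ _ n1 p1 p2 d3.symm, C3 _ y _ _ n1 hy p1 p2 c1 e1]
      rcases eq_or_lt_of_le q with q | q
      · exact Or.inl (posArc_inj y _ _ hy p2 p1 q)
      · exact Or.inr ⟨q2, q⟩
    · rw [arcOC_iff _ _ _ n2 p2 p2 e3.symm]
      exact Or.inl rfl

lemma vert_lt (S : CyclicPolygon) {y : ℂ} (hy : y ∈ S.V) :
    posArc y (S.next y) < posArc y (S.prev y) := by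
  have c := S.C_vert hy
  obtain ⟨d1, d2, d3⟩ := C_ne' c
  rw [posArc_lt_iff y _ _ (S.onCircle _ hy) (S.onCircle _ (S.next_mem hy))
    (S.onCircle _ (S.prev_mem hy)) d2.symm d1]
  exact C_rot.1 c

/-- Compatibility of the positions `p`, `q` of points `u`, `v`. -/
def Cp (p q : ℂ → ℝ) (W : Finset ℂ) : Prop :=
  ∀ u ∈ W, ∀ v ∈ W, u ≠ v → (p u < q v ↔ th u < th v)

lemma Cp3 {p q r : ℂ → ℝ} {W : Finset ℂ} (h1 : Cp p q W) (h2 : Cp q r W) (h3 : Cp r p W)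
    {a b c : ℂ} (ha : a ∈ W) (hb : b ∈ W) (hc : c ∈ W) (hab : a ≠ b) (hbc : b ≠ c) (hca : c ≠ a) :
    C (p a) (q b) (r c) ↔ C (th a) (th b) (th c) := by
  unfold C
  rw [h1 a ha b hb hab, h2 b hb c hc hbc, h3 c hc a ha hca]

lemma Cp2 {p q r : ℂ → ℝ} {W : Finset ℂ} (hW : ∀ v ∈ W, ‖v‖ = 1) (h2 : Cp q r W) (h3 : Cp r p W)
    {a c : ℂ} (ha : a ∈ W) (hc : c ∈ W) (hca : c ≠ a) :
    C (p a) (q a) (r c) ↔ p a < q a := by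
  unfold C
  rw [h2 a ha c hc hca.symm, h3 c hc a ha hca]
  have : th c ≠ th a := fun h => hca (th_inj (hW c hc) (hW a ha) h)
  rcases lt_or_gt_of_ne this with q | q
  · simp [q, q.not_gt]
  · simp [q, q.not_gt]

lemma Il_comm {a b c d : ℝ} : Il a b c d ↔ Il b a c d := by
  have e1 : C b c a ↔ C a b c := C_rot.symm
  have e2 : C b a d ↔ C a d b := C_rot
  have e3 : C b d a ↔ C a b d := C_rot.symm
  have e4 : C b a c ↔ C a c b := C_rot
  unfold Il
  rw [e1, e2, e3, e4]
  tauto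

lemma Il_comm' {a b c d : ℝ} : Il a b c d ↔ Il a b d c := by
  unfold Il
  tauto

/-- Direction: the copy of `y` for `S₁` goes to the anticlockwise side. -/
def Dir (S₁ S₂ : CyclicPolygon) (y : ℂ) : Prop :=
  posArc y (S₁.prev y) ≤ posArc y (S₂.next y)

lemma ne_of_link (S : CyclicPolygon) {y x : ℂ} (hy : y ∈ S.V) (hx : x = S.next y ∨ x = S.prev y) :
    x ∈ S.V ∧ x ≠ y ∧ posArc y (S.next y) ≤ posArc y x ∧ posArc y x ≤ posArc y (S.prev y) := by
  obtain ⟨d1, d2, d3⟩ := C_ne' (S.C_vert hy)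
  have := vert_lt S hy
  rcases hx with rfl | rfl
  · exact ⟨S.next_mem hy, d2.symm, le_refl _, this.le⟩
  · exact ⟨S.prev_mem hy, d1, this.le, le_refl _⟩

lemma dir_iff (S₁ S₂ : CyclicPolygon) (hind : IndepPolygons S₁ S₂) {y x z : ℂ} (h1 : y ∈ S₁.V)
    (h2 : y ∈ S₂.V) (hx : x = S₁.next y ∨ x = S₁.prev y) (hz : z = S₂.next y ∨ z = S₂.prev y)
    (hxz : x ≠ z) : (Dir S₁ S₂ y → C (th y) (th x) (th z)) ∧
      (¬ Dir S₁ S₂ y → C (th y) (th z) (th x)) := by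
  obtain ⟨mx, nx, x1, x2⟩ := ne_of_link S₁ h1 hx
  obtain ⟨mz, nz, z1, z2⟩ := ne_of_link S₂ h2 hz
  have ux := S₁.onCircle _ mx
  have uz := S₂.onCircle _ mz
  have uy := S₁.onCircle _ h1
  rw [← posArc_lt_iff y x z uy ux uz nx nz, ← posArc_lt_iff y z x uy uz ux nz nx]
  have hne : posArc y x ≠ posArc y z := fun h => hxz (posArc_inj y x z uy ux uz h)
  have := indep_sep S₁ S₂ hind y h1 h2
  unfold Dir
  constructor
  · intro h
    exact lt_of_le_of_ne (by linarith) hne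
  · intro h
    rcases this with q | q
    · exact absurd q h
    · exact lt_of_le_of_ne (by linarith) hne.symm

section
variable {S₁ S₂ : CyclicPolygon} {p₁ p₂ : ℂ → ℝ}

/-- Edges sharing exactly one endpoint do not cross after splitting. -/
lemma share_one (hind : IndepPolygons S₁ S₂)
    (c11 : Cp p₁ p₁ (S₁.V ∪ S₂.V)) (c12 : Cp p₁ p₂ (S₁.V ∪ S₂.V)) (c21 : Cp p₂ p₁ (S₁.V ∪ S₂.V))
    (hd : ∀ y, Dir S₁ S₂ y ↔ p₂ y < p₁ y) (hW : ∀ v ∈ S₁.V ∪ S₂.V, ‖v‖ = 1)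
    {y x z : ℂ} (h1 : y ∈ S₁.V)
    (h2 : y ∈ S₂.V) (hx : x = S₁.next y ∨ x = S₁.prev y) (hz : z = S₂.next y ∨ z = S₂.prev y)
    (hxz : x ≠ z) : ¬ Il (p₁ y) (p₁ x) (p₂ y) (p₂ z) := by
  obtain ⟨d1, d2⟩ := dir_iff S₁ S₂ hind h1 h2 hx hz hxz
  obtain ⟨mx, nx, x1, x2⟩ := ne_of_link S₁ h1 hx
  obtain ⟨mz, nz, z1, z2⟩ := ne_of_link S₂ h2 hz
  have wy : y ∈ S₁.V ∪ S₂.V := Finset.mem_union_left _ h1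
  have wx : x ∈ S₁.V ∪ S₂.V := Finset.mem_union_left _ mx
  have wz : z ∈ S₁.V ∪ S₂.V := Finset.mem_union_right _ mz
  unfold Il
  rw [Cp2 hW c21 c11 wy wx nx, Cp3 c11 c12 c21 wy wx wz nx.symm hxz nz,
    Cp3 c12 c21 c11 wy wz wx nz.symm hxz.symm nx,
    show C (p₁ y) (p₁ x) (p₂ y) ↔ C (p₂ y) (p₁ y) (p₁ x) from C_rot.symm,
    Cp2 hW c11 c12 wy wx nx, ← hd]
  have as : C (th y) (th x) (th z) → ¬ C (th y) (th z) (th x) := by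
    unfold C
    rintro (h | h | h) (h' | h' | h') <;> linarith [h.1, h.2, h'.1, h'.2]
  rintro (⟨a, b⟩ | ⟨a, b⟩)
  · exact as b (d2 (by rw [hd]; exact a.not_gt))
  · exact as (d1 b) a

/-- Opposite edges do not cross after splitting. -/
lemma share_two (hind : IndepPolygons S₁ S₂)
    (c11 : Cp p₁ p₁ (S₁.V ∪ S₂.V)) (c12 : Cp p₁ p₂ (S₁.V ∪ S₂.V)) (c21 : Cp p₂ p₁ (S₁.V ∪ S₂.V))
    (hd : ∀ y, Dir S₁ S₂ y ↔ p₂ y < p₁ y) (hW : ∀ v ∈ S₁.V ∪ S₂.V, ‖v‖ = 1)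
    {a b : ℂ} (h1 : (a, b) ∈ S₁.E) (h2 : (b, a) ∈ S₂.E) : ¬ Il (p₁ a) (p₁ b) (p₂ b) (p₂ a) := by
  have ma := (S₁.endmem _ h1).1
  have mb := (S₁.endmem _ h1).2
  have ma' := (S₂.endmem _ h2).2
  have mb' := (S₂.endmem _ h2).1
  simp only at ma mb ma' mb'
  have hne := S₁.edge_ne h1
  have wa : a ∈ S₁.V ∪ S₂.V := Finset.mem_union_left _ ma
  have wb : b ∈ S₁.V ∪ S₂.V := Finset.mem_union_left _ mb
  have da : ¬ Dir S₁ S₂ a := by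
    unfold Dir
    have v1 := vert_lt S₁ ma
    have v2 := vert_lt S₂ ma'
    rw [S₁.next_eq h1] at v1
    rw [S₂.prev_eq h2] at v2
    linarith
  have db : Dir S₁ S₂ b := by
    unfold Dir
    rw [S₁.prev_eq h1, S₂.next_eq h2]
  rw [hd] at da db
  unfold Il
  rw [show C (p₁ a) (p₁ b) (p₂ a) ↔ C (p₂ a) (p₁ a) (p₁ b) from C_rot.symm,
    Cp2 hW c11 c12 wa wb hne.symm,
    show C (p₁ a) (p₁ b) (p₂ b) ↔ C (p₁ b) (p₂ b) (p₁ a) from C_rot, Cp2 hW c21 c11 wb wa hne]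
  rintro (⟨_, h⟩ | ⟨_, h⟩)
  · exact da h
  · exact absurd db h.not_gt

lemma not_same (hind : IndepPolygons S₁ S₂) {a b : ℂ} (h1 : (a, b) ∈ S₁.E) (h2 : (a, b) ∈ S₂.E) :
    False := by
  have ma := (S₁.endmem _ h1).1
  have ma' := (S₂.endmem _ h2).1
  have v1 := vert_lt S₁ ma
  have v2 := vert_lt S₂ ma'
  have := indep_sep S₁ S₂ hind a ma ma'
  simp only at v1 v2
  rw [S₁.next_eq h1] at v1 this
  rw [S₂.next_eq h2] at v2 this
  rcases this with h | h <;> linarith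

lemma cross_main (hind : IndepPolygons S₁ S₂)
    (c11 : Cp p₁ p₁ (S₁.V ∪ S₂.V)) (c12 : Cp p₁ p₂ (S₁.V ∪ S₂.V)) (c21 : Cp p₂ p₁ (S₁.V ∪ S₂.V))
    (hd : ∀ y, Dir S₁ S₂ y ↔ p₂ y < p₁ y) (hW : ∀ v ∈ S₁.V ∪ S₂.V, ‖v‖ = 1)
    {a b c d : ℂ} (h1 : (a, b) ∈ S₁.E) (h2 : (c, d) ∈ S₂.E) :
    Il (p₁ a) (p₁ b) (p₂ c) (p₂ d) ↔ Il (th a) (th b) (th c) (th d) := by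
  have ma := (S₁.endmem _ h1).1
  have mb := (S₁.endmem _ h1).2
  have mc := (S₂.endmem _ h2).1
  have md := (S₂.endmem _ h2).2
  simp only at ma mb mc md
  have hab := S₁.edge_ne h1
  have hcd := S₂.edge_ne h2
  have wa : a ∈ S₁.V ∪ S₂.V := Finset.mem_union_left _ ma
  have wb : b ∈ S₁.V ∪ S₂.V := Finset.mem_union_left _ mb
  have wc : c ∈ S₁.V ∪ S₂.V := Finset.mem_union_right _ mc
  have wd : d ∈ S₁.V ∪ S₂.V := Finset.mem_union_right _ md
  have nIl : (a = c ∨ a = d ∨ b = c ∨ b = d) → ¬ Il (th a) (th b) (th c) (th d) := by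
    intro h hI
    rcases hI with ⟨q, r⟩ | ⟨q, r⟩ <;> have q' := C_ne' q <;> have r' := C_ne' r <;>
      rcases h with h | h | h | h <;> simp_all
  have b_a : b = S₁.next a ∨ b = S₁.prev a := Or.inl (S₁.next_eq h1).symm
  have a_b : a = S₁.next b ∨ a = S₁.prev b := Or.inr (S₁.prev_eq h1).symm
  have d_c : d = S₂.next c ∨ d = S₂.prev c := Or.inl (S₂.next_eq h2).symm
  have c_d : c = S₂.next d ∨ c = S₂.prev d := Or.inr (S₂.prev_eq h2).symm
  by_cases hac : a = c
  · refine iff_of_false ?_ (nIl (Or.inl hac))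
    subst hac
    by_cases hbd : b = d
    · subst hbd; exact (not_same hind h1 h2).elim
    · exact share_one hind c11 c12 c21 hd hW ma mc b_a d_c hbd
  by_cases had : a = d
  · refine iff_of_false ?_ (nIl (Or.inr (Or.inl had)))
    subst had
    by_cases hbc : b = c
    · subst hbc; exact share_two hind c11 c12 c21 hd hW h1 h2
    · rw [Il_comm']
      exact share_one hind c11 c12 c21 hd hW ma md b_a c_d hbc
  by_cases hbc : b = c
  · refine iff_of_false ?_ (nIl (Or.inr (Or.inr (Or.inl hbc))))
    subst hbc
    rw [Il_comm]
    exact share_one hind c11 c12 c21 hd hW mb mc a_b d_c had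
  by_cases hbd : b = d
  · refine iff_of_false ?_ (nIl (Or.inr (Or.inr (Or.inr hbd))))
    subst hbd
    rw [Il_comm, Il_comm']
    exact share_one hind c11 c12 c21 hd hW mb md a_b c_d hac
  unfold Il
  rw [Cp3 c12 c21 c11 wa wc wb hac (Ne.symm hbc) hab.symm, Cp3 c11 c12 c21 wa wb wd hab hbd (Ne.symm had),
    Cp3 c12 c21 c11 wa wd wb had (Ne.symm hbd) hab.symm, Cp3 c11 c12 c21 wa wb wc hab hbc (Ne.symm hac)]

lemma C_asymm {a b c : ℝ} (h : C a b c) : ¬ C c b a := by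
  unfold C at *
  rintro (h' | h' | h') <;> rcases h with h | h | h <;> linarith [h.1, h.2, h'.1, h'.2]

lemma link_main (hind : IndepPolygons S₁ S₂)
    (c11 : Cp p₁ p₁ (S₁.V ∪ S₂.V)) (c12 : Cp p₁ p₂ (S₁.V ∪ S₂.V)) (c21 : Cp p₂ p₁ (S₁.V ∪ S₂.V))
    (c22 : Cp p₂ p₂ (S₁.V ∪ S₂.V))
    (hd : ∀ y, Dir S₁ S₂ y ↔ p₂ y < p₁ y) (hW : ∀ v ∈ S₁.V ∪ S₂.V, ‖v‖ = 1)
    {a b : ℂ} (ha : a ∈ S₁.V) (hb : b ∈ S₂.V) :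
    (C (p₁ (S₁.next a)) (p₂ b) (p₁ (S₁.prev a)) ∧ C (p₂ (S₂.next b)) (p₁ a) (p₂ (S₂.prev b))) ↔
      (a ≠ b ∧ C (th (S₁.next a)) (th b) (th (S₁.prev a)) ∧
        C (th (S₂.next b)) (th a) (th (S₂.prev b))) := by
  have wa : a ∈ S₁.V ∪ S₂.V := Finset.mem_union_left _ ha
  have wb : b ∈ S₁.V ∪ S₂.V := Finset.mem_union_right _ hb
  have wan : S₁.next a ∈ S₁.V ∪ S₂.V := Finset.mem_union_left _ (S₁.next_mem ha)
  have wap : S₁.prev a ∈ S₁.V ∪ S₂.V := Finset.mem_union_left _ (S₁.prev_mem ha)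
  have wbn : S₂.next b ∈ S₁.V ∪ S₂.V := Finset.mem_union_right _ (S₂.next_mem hb)
  have wbp : S₂.prev b ∈ S₁.V ∪ S₂.V := Finset.mem_union_right _ (S₂.prev_mem hb)
  obtain ⟨a1, a2, a3⟩ := C_ne' (S₁.C_vert ha)
  obtain ⟨b1, b2, b3⟩ := C_ne' (S₂.C_vert hb)
  by_cases hab : a = b
  · subst hab
    refine iff_of_false ?_ (by simp)
    rintro ⟨h, -⟩
    rw [Cp3 c12 c21 c11 wan wa wap a2.symm a1.symm a3] at h
    exact C_asymm h (S₁.C_vert ha)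
  have L1 : b ≠ S₁.next a → b ≠ S₁.prev a → (C (p₁ (S₁.next a)) (p₂ b) (p₁ (S₁.prev a)) ↔
      C (th (S₁.next a)) (th b) (th (S₁.prev a))) := fun h h' =>
    Cp3 c12 c21 c11 wan wb wap h.symm h' a3
  have L2 : a ≠ S₂.next b → a ≠ S₂.prev b → (C (p₂ (S₂.next b)) (p₁ a) (p₂ (S₂.prev b)) ↔
      C (th (S₂.next b)) (th a) (th (S₂.prev b))) := fun h h' =>
    Cp3 c21 c12 c22 wbn wa wbp h.symm h' b3
  have uA := hW a wa
  have uB := hW b wb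
  have sepb : ∀ hb1 : b ∈ S₁.V, (a = S₁.prev b ∧ ¬ Dir S₁ S₂ b) ∨ (a = S₁.next b ∧ Dir S₁ S₂ b) →
      ¬ C (p₂ (S₂.next b)) (p₁ a) (p₂ (S₂.prev b)) := by
    intro hb1 h
    have v1 := vert_lt S₁ hb1
    have v2 := vert_lt S₂ hb
    have sp := indep_sep S₁ S₂ hind b hb1 hb
    have k : posArc b a < posArc b (S₂.next b) ∨ posArc b (S₂.prev b) < posArc b a := by
      rcases h with ⟨e, h⟩ | ⟨e, h⟩
      · right
        rw [← e] at v1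
        have := sp.resolve_left h
        linarith
      · left
        rw [← e] at v1
        unfold Dir at h
        linarith
    have n1 : a ≠ S₂.next b := by
      intro e; rw [← e] at k v2; rcases k with k | k <;> linarith
    have n2 : a ≠ S₂.prev b := by
      intro e; rw [← e] at k v2; rcases k with k | k <;> linarith
    rw [L2 n1 n2, C3 _ b _ _ (hW _ wbn) uB (hW _ wbp) uA (S₂.C_vert hb) hab]
    rintro ⟨r1, r2⟩
    rcases k with k | k <;> linarith
  have sepa : ∀ ha2 : a ∈ S₂.V, (b = S₂.prev a ∧ Dir S₁ S₂ a) ∨ (b = S₂.next a ∧ ¬ Dir S₁ S₂ a) →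
      ¬ C (p₁ (S₁.next a)) (p₂ b) (p₁ (S₁.prev a)) := by
    intro ha2 h
    have v1 := vert_lt S₁ ha
    have v2 := vert_lt S₂ ha2
    have sp := indep_sep S₁ S₂ hind a ha ha2
    have k : posArc a b < posArc a (S₁.next a) ∨ posArc a (S₁.prev a) < posArc a b := by
      rcases h with ⟨e, h⟩ | ⟨e, h⟩
      · right
        rw [← e] at v2
        unfold Dir at h
        linarith
      · left
        rw [← e] at v2
        have := sp.resolve_left h
        linarith
    have n1 : b ≠ S₁.next a := by
      intro e; rw [← e] at k v1; rcases k with k | k <;> linarith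
    have n2 : b ≠ S₁.prev a := by
      intro e; rw [← e] at k v1; rcases k with k | k <;> linarith
    rw [L1 n1 n2, C3 _ a _ _ (hW _ wan) uA (hW _ wap) uB (S₁.C_vert ha) (Ne.symm hab)]
    rintro ⟨r1, r2⟩
    rcases k with k | k <;> linarith
  by_cases q1 : b = S₁.next a
  · refine iff_of_false ?_ ?_
    · rintro ⟨r1, r2⟩
      have hb1 : b ∈ S₁.V := q1 ▸ S₁.next_mem ha
      have e : a = S₁.prev b := by rw [q1]; exact (S₁.prev_eq (S₁.edge_next ha)).symm
      rw [← q1, Cp2 hW c21 c11 wb wap (by rw [q1]; exact a3)] at r1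
      exact sepb hb1 (Or.inl ⟨e, by rw [hd]; exact r1.not_gt⟩) r2
    · rintro ⟨-, r, -⟩
      exact (C_ne' r).1 q1.symm
  by_cases q2 : b = S₁.prev a
  · refine iff_of_false ?_ ?_
    · rintro ⟨r1, r2⟩
      have hb1 : b ∈ S₁.V := q2 ▸ S₁.prev_mem ha
      have e : a = S₁.next b := by rw [q2]; exact (S₁.next_eq (S₁.edge_prev ha)).symm
      rw [← q2, C_rot, Cp2 hW c11 c12 wb wan (Ne.symm q1)] at r1
      exact sepb hb1 (Or.inr ⟨e, by rw [hd]; exact r1⟩) r2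
    · rintro ⟨-, r, -⟩
      exact (C_ne' r).2.1 q2
  by_cases q3 : a = S₂.next b
  · refine iff_of_false ?_ ?_
    · rintro ⟨r1, r2⟩
      have ha2 : a ∈ S₂.V := q3 ▸ S₂.next_mem hb
      have e : b = S₂.prev a := by rw [q3]; exact (S₂.prev_eq (S₂.edge_next hb)).symm
      rw [← q3, Cp2 hW c12 c22 wa wbp (by rw [q3]; exact b3)] at r2
      exact sepa ha2 (Or.inl ⟨e, by rw [hd]; exact r2⟩) r1
    · rintro ⟨-, -, r⟩
      exact (C_ne' r).1 q3.symm
  by_cases q4 : a = S₂.prev b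
  · refine iff_of_false ?_ ?_
    · rintro ⟨r1, r2⟩
      have ha2 : a ∈ S₂.V := q4 ▸ S₂.prev_mem hb
      have e : b = S₂.next a := by rw [q4]; exact (S₂.next_eq (S₂.edge_prev hb)).symm
      rw [← q4, C_rot, Cp2 hW c22 c21 wa wbn (Ne.symm q3)] at r2
      exact sepa ha2 (Or.inr ⟨e, by rw [hd]; exact r2.not_gt⟩) r1
    · rintro ⟨-, -, r⟩
      exact (C_ne' r).2.1 q4
  rw [L1 q1 q2, L2 q3 q4]
  simp [hab]

end

lemma cp_gap (S₁ S₂ : CyclicPolygon) (ε : ℝ) (hε : 0 < ε)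
    (hW : ∀ v ∈ S₁.V ∪ S₂.V, ‖v‖ = 1)
    (hg : ∀ u ∈ S₁.V ∪ S₂.V, ∀ v ∈ S₁.V ∪ S₂.V, th u < th v → th u < th v - ε)
    (p q : ℂ → ℝ) (hp : ∀ v, p v = th v ∨ p v = th v - ε) (hq : ∀ v, q v = th v ∨ q v = th v - ε) :
    Cp p q (S₁.V ∪ S₂.V) := by
  intro u hu v hv huv
  have hne : th u ≠ th v := fun h => huv (th_inj (hW u hu) (hW v hv) h)
  rcases lt_or_gt_of_ne hne with h | h
  · have := hg u hu v hv h
    simp only [h, iff_true]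
    rcases hp u with e | e <;> rcases hq v with e' | e' <;> linarith
  · have := hg v hv u hu h
    simp only [h.not_gt, iff_false, not_lt]
    rcases hp u with e | e <;> rcases hq v with e' | e' <;> linarith

/-- Two mutually independent stars with a common vertex can be replaced by
mutually independent stars on disjoint vertex sets, isomorphic as directed graphs, preserving
crossings of pairs of edges and linkability of pairs of vertices. -/
theorem split_common_vertices (S₁ S₂ : CyclicPolygon) (h₁ : IsStar S₁) (h₂ : IsStar S₂)
    (hind : IndepPolygons S₁ S₂) (hcap : ∃ v, v ∈ S₁.V ∧ v ∈ S₂.V) :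
    ∃ (S₁' S₂' : CyclicPolygon) (φ₁ φ₂ : ℂ → ℂ),
      IsStar S₁' ∧ IsStar S₂' ∧ IndepPolygons S₁' S₂' ∧
      (∀ x, ¬ (x ∈ S₁'.V ∧ x ∈ S₂'.V)) ∧
      Set.BijOn φ₁ (S₁.V : Set ℂ) (S₁'.V : Set ℂ) ∧
      Set.BijOn φ₂ (S₂.V : Set ℂ) (S₂'.V : Set ℂ) ∧
      (∀ a b : ℂ, a ∈ S₁.V → b ∈ S₁.V → ((a, b) ∈ S₁.E ↔ (φ₁ a, φ₁ b) ∈ S₁'.E)) ∧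
      (∀ a b : ℂ, a ∈ S₂.V → b ∈ S₂.V → ((a, b) ∈ S₂.E ↔ (φ₂ a, φ₂ b) ∈ S₂'.E)) ∧
      (∀ e ∈ S₁.E, ∀ f ∈ S₂.E,
        (Crossing (φ₁ e.1) (φ₁ e.2) (φ₂ f.1) (φ₂ f.2) ↔ Crossing e.1 e.2 f.1 f.2)) ∧
      (∀ a ∈ S₁.V, ∀ b ∈ S₂.V,
        (LinkablePair S₁' S₂' (φ₁ a) (φ₂ b) ↔ LinkablePair S₁ S₂ a b)) := by
  obtain ⟨ε, hε, hT⟩ := exists_gap (insert 0 ((S₁.V ∪ S₂.V).image th))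
  have hW : ∀ v ∈ S₁.V ∪ S₂.V, ‖v‖ = 1 := by
    intro v hv
    rcases Finset.mem_union.1 hv with h | h
    · exact S₁.onCircle v h
    · exact S₂.onCircle v h
  have hg : ∀ u ∈ S₁.V ∪ S₂.V, ∀ v ∈ S₁.V ∪ S₂.V, th u < th v → th u < th v - ε :=
    fun u hu v hv h => hT _ (Finset.mem_insert_of_mem (Finset.mem_image_of_mem _ hu)) _
      (Finset.mem_insert_of_mem (Finset.mem_image_of_mem _ hv)) h
  have hg0 : ∀ v ∈ S₁.V ∪ S₂.V, 0 < th v - ε :=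
    fun v hv => hT _ (Finset.mem_insert_self _ _) _
      (Finset.mem_insert_of_mem (Finset.mem_image_of_mem _ hv)) (th_pos v)
  obtain ⟨p₁, hp₁⟩ : ∃ p : ℂ → ℝ, ∀ v, p v = if Dir S₁ S₂ v then th v else th v - ε :=
    ⟨_, fun _ => rfl⟩
  obtain ⟨p₂, hp₂⟩ : ∃ p : ℂ → ℝ, ∀ v, p v = if Dir S₁ S₂ v then th v - ε else th v :=
    ⟨_, fun _ => rfl⟩
  have o₁ : ∀ v, p₁ v = th v ∨ p₁ v = th v - ε := by
    intro v; rw [hp₁]; split_ifs <;> simp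
  have o₂ : ∀ v, p₂ v = th v ∨ p₂ v = th v - ε := by
    intro v; rw [hp₂]; split_ifs <;> simp
  have hd : ∀ y, Dir S₁ S₂ y ↔ p₂ y < p₁ y := by
    intro y
    rw [hp₁, hp₂]
    split_ifs with h
    · simp [h, hε]
    · simp [h, hε.le]
  have hne : ∀ y, p₁ y ≠ p₂ y := by
    intro y h
    rw [hp₁, hp₂] at h
    split_ifs at h <;> linarith
  have cp := cp_gap S₁ S₂ ε hε hW hg
  have c11 := cp p₁ p₁ o₁ o₁
  have c12 := cp p₁ p₂ o₁ o₂
  have c21 := cp p₂ p₁ o₂ o₁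
  have c22 := cp p₂ p₂ o₂ o₂
  have bd : ∀ p : ℂ → ℝ, (∀ v, p v = th v ∨ p v = th v - ε) → ∀ v ∈ S₁.V ∪ S₂.V,
      0 < p v ∧ p v ≤ 2 * Real.pi := by
    intro p hp v hv
    have := hg0 v hv
    have := th_le v
    rcases hp v with e | e <;> rw [e] <;> constructor <;> linarith
  have G₁ : Good S₁ p₁ := by
    refine ⟨fun v hv => bd p₁ o₁ v (Finset.mem_union_left _ hv), fun u hu v hv => ?_⟩
    by_cases h : u = v
    · subst h; simp
    · exact c11 u (Finset.mem_union_left _ hu) v (Finset.mem_union_left _ hv) h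
  have G₂ : Good S₂ p₂ := by
    refine ⟨fun v hv => bd p₂ o₂ v (Finset.mem_union_right _ hv), fun u hu v hv => ?_⟩
    by_cases h : u = v
    · subst h; simp
    · exact c22 u (Finset.mem_union_right _ hu) v (Finset.mem_union_right _ hv) h
  have dis : ∀ a ∈ S₁.V, ∀ b ∈ S₂.V, ph p₁ a ≠ ph p₂ b := by
    intro a ha b hb h
    have e : p₁ a = p₂ b := by rw [← G₁.th_ph ha, ← G₂.th_ph hb, h]
    have wa : a ∈ S₁.V ∪ S₂.V := Finset.mem_union_left _ ha
    have wb : b ∈ S₁.V ∪ S₂.V := Finset.mem_union_right _ hb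
    by_cases hab : a = b
    · subst hab; exact hne a e
    · have h1 := c12 a wa b wb hab
      have h2 := c21 b wb a wa (Ne.symm hab)
      rw [e] at h1 h2
      simp only [lt_self_iff_false, false_iff, not_lt] at h1 h2
      exact hab (th_inj (hW a wa) (hW b wb) (le_antisymm h2 h1))
  have disj : ∀ x, ¬ (x ∈ (mapPoly S₁ p₁ G₁).V ∧ x ∈ (mapPoly S₂ p₂ G₂).V) := by
    rintro x ⟨hx, hx'⟩
    obtain ⟨a, ha, rfl⟩ := Finset.mem_image.1 hx
    obtain ⟨b, hb, e⟩ := Finset.mem_image.1 hx'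
    exact dis a ha b hb e.symm
  refine ⟨mapPoly S₁ p₁ G₁, mapPoly S₂ p₂ G₂, ph p₁, ph p₂, map_star G₁ h₁, map_star G₂ h₂, ?_,
    disj, map_bij G₁, map_bij G₂, fun a b ha hb => map_edge G₁ ha hb,
    fun a b ha hb => map_edge G₂ ha hb, ?_, ?_⟩
  · rintro ⟨y, h, h', -⟩
    exact disj y ⟨h, h'⟩
  · rintro ⟨a, b⟩ he ⟨c, d⟩ hf
    have ma := (S₁.endmem _ he).1
    have mb := (S₁.endmem _ he).2
    have mc := (S₂.endmem _ hf).1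
    have md := (S₂.endmem _ hf).2
    simp only at ma mb mc md ⊢
    have hab := S₁.edge_ne he
    rw [crossing_iff _ _ _ _ (norm_ph _ _) (norm_ph _ _) (norm_ph _ _) (norm_ph _ _)
      (fun q => hab (G₁.inj ma mb q)), crossing_iff _ _ _ _ (S₁.onCircle _ ma) (S₁.onCircle _ mb)
      (S₂.onCircle _ mc) (S₂.onCircle _ md) hab, G₁.th_ph ma, G₁.th_ph mb, G₂.th_ph mc,
      G₂.th_ph md]
    exact cross_main hind c11 c12 c21 hd hW he hf
  · intro a ha b hb
    rw [linkable_iff _ _ _ _ (mem_map G₁ ha) (mem_map G₂ hb), linkable_iff _ _ _ _ ha hb,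
      map_next G₁ ha, map_prev G₁ ha, map_next G₂ hb, map_prev G₂ hb, G₁.th_ph ha, G₂.th_ph hb,
      G₁.th_ph (S₁.next_mem ha), G₁.th_ph (S₁.prev_mem ha), G₂.th_ph (S₂.next_mem hb),
      G₂.th_ph (S₂.prev_mem hb)]
    rw [← link_main hind c11 c12 c21 c22 hd hW ha hb]
    simp [dis a ha b hb]

end
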